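/- arXiv:1310.5455 — 3 statements merged into one kernel-verified Lean document; each statement's English description precedes it below -/
import Mathlib

section
/- Let F be algebraically closed of characteristic ≠ 3. An F-linear endomorphism d of O = sl₃(F) is a derivation of the Okubo product (i.e., d(x*y) = d(x)*y + x*d(y) for all x, y ∈ O) if and only if there exists a ∈ O with d(y) = a*y − y*a for all y ∈ O; moreover such a is unique. In particular the Lie algebra of derivations of (O,*) equals {ad*_a : a ∈ O} and is isomorphic to sl₃(F). -/
variable {F : Type} [Field F]

def okm (ω : F) (x y : Matrix (Fin 3) (Fin 3) F) : Matrix (Fin 3) (Fin 3) F :=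
  ω • (x * y) - ω ^ 2 • (y * x) -
    (((ω - ω ^ 2) / 3) * (x * y).trace) • (1 : Matrix (Fin 3) (Fin 3) F)

lemma okubo_okubo_three_ne_zero (ω : F) (hω : ω ^ 2 + ω + 1 = 0) (hω1 : ω ≠ 1) : (3 : F) ≠ 0 := by
  intro h3
  apply hω1
  have h2 : (ω - 1) ^ 2 = 0 := by linear_combination hω - ω * h3
  have := pow_eq_zero_iff (n := 2) (by norm_num) |>.mp h2
  exact sub_eq_zero.mp this

lemma okm_trace (ω : F) (hω : ω ^ 2 + ω + 1 = 0) (hω1 : ω ≠ 1)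
    (x y : Matrix (Fin 3) (Fin 3) F) : (okm ω x y).trace = 0 := by
  have h3 := okubo_okubo_three_ne_zero ω hω hω1
  have h : (okm ω x y).trace =
      ω * (x * y).trace - ω ^ 2 * (x * y).trace - ((ω - ω ^ 2) / 3) * (x * y).trace * 3 := by
    simp [okm, Matrix.trace_sub, Matrix.trace_smul, smul_eq_mul, Matrix.trace_one,
      Matrix.trace_mul_comm y x]
  rw [h]
  field_simp
  ring

/-- `sl₃(F)`, the space `O` of trace-zero `3×3` matrices. -/
def sl3 (F : Type) [Field F] : Submodule F (Matrix (Fin 3) (Fin 3) F) :=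
  LinearMap.ker (Matrix.traceLinearMap (Fin 3) F F)

/-- The Okubo product as an operation on `O = sl₃(F)`. -/
def okmS (ω : F) (hω : ω ^ 2 + ω + 1 = 0) (hω1 : ω ≠ 1) (x y : sl3 F) : sl3 F :=
  ⟨okm ω (x : Matrix (Fin 3) (Fin 3) F) (y : Matrix (Fin 3) (Fin 3) F),
    by simpa [sl3, LinearMap.mem_ker] using okm_trace ω hω hω1 x y⟩

/-- Every derivation of a matrix algebra is inner. -/
lemma exists_eq_mul_sub_mul_of_leibniz {R n : Type*} [CommRing R] [Fintype n] [DecidableEq n]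
    (D : Matrix n n R →ₗ[R] Matrix n n R) (hD : ∀ x y, D (x * y) = D x * y + x * D y) :
    ∃ m : Matrix n n R, ∀ x, D x = m * x - x * m := by
  rcases isEmpty_or_nonempty n with hn | ⟨⟨k⟩⟩
  · exact ⟨0, fun x => Subsingleton.elim _ _⟩
  refine ⟨∑ i, D (Matrix.single i k 1) * Matrix.single k i 1, fun x => ?_⟩
  have hrow (i : n) : Matrix.single k i 1 * x = ∑ j, x i j • Matrix.single k j (1 : R) := by
    ext a b
    rcases eq_or_ne a k with rfl | ha
    · simp [Matrix.sum_apply, Matrix.single_apply, Matrix.mul_apply]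
    · simp [Matrix.sum_apply, ha, ha.symm]
  have hcol (j : n) : x * Matrix.single j k 1 = ∑ i, x i j • Matrix.single i k (1 : R) := by
    ext a b
    rcases eq_or_ne b k with rfl | hb
    · simp [Matrix.sum_apply, Matrix.single_apply, Matrix.mul_apply]
    · simp [Matrix.sum_apply, hb, hb.symm]
  have hone : ∑ j, Matrix.single j k (1 : R) * Matrix.single k j 1 = 1 := by
    simp [Matrix.sum_single_one]
  have key : (∑ i, D (Matrix.single i k 1) * Matrix.single k i 1) * x =
      ∑ j, D (x * Matrix.single j k 1) * Matrix.single k j 1 := by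
    simp_rw [hcol, Finset.sum_mul, mul_assoc, hrow, map_sum, map_smul, Finset.sum_mul,
      Finset.mul_sum, smul_mul_assoc, mul_smul_comm]
    exact Finset.sum_comm
  rw [key]
  simp_rw [hD, add_mul, Finset.sum_add_distrib, mul_assoc, ← Finset.mul_sum, hone]
  simp

/-- On a central algebra, a linear map which kills `1` and satisfies the Leibniz rule up to scalars
satisfies it exactly. -/
lemma leibniz_of_leibniz_mod_scalars {K A : Type*} [Field K] [Ring A] [Algebra K A]
    [Algebra.IsCentral K A] (D : A →ₗ[K] A) (h1 : D 1 = 0)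
    (hD : ∀ x y, ∃ c : K, D (x * y) = D x * y + x * D y + c • (1 : A)) (y z : A) :
    D (y * z) = D y * z + y * D z := by
  choose c hc using hD
  by_cases h0 : c y z = 0
  · simpa [h0] using hc y z
  have hz : z ∈ Subalgebra.center K A := by
    rw [Subalgebra.mem_center_iff]
    intro x
    have hx : c y z • x = c x y • z + (c (x * y) z - c x (y * z)) • (1 : A) := by
      have h := congrArg D (mul_assoc x y z)
      rw [hc (x * y), hc x (y * z), hc x y, hc y z] at h
      simp only [add_mul, mul_add, smul_mul_assoc, mul_smul_comm, one_mul, mul_one, mul_assoc] at h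
      rw [sub_smul]
      linear_combination (norm := module) -h
    have hcomm : c y z • (x * z) = c y z • (z * x) := by
      rw [← smul_mul_assoc, ← mul_smul_comm, hx]
      simp [add_mul, mul_add]
    exact smul_right_injective A h0 hcomm
  obtain ⟨t, rfl⟩ := Algebra.mem_bot.mp (Algebra.IsCentral.out hz)
  simp [Algebra.algebraMap_eq_smul_one, h1]

lemma mem_sl3 {x : Matrix (Fin 3) (Fin 3) F} : x ∈ sl3 F ↔ x.trace = 0 := by
  simp [sl3, LinearMap.mem_ker]

/-- The projection of `3×3` matrices onto `sl₃` along the scalar matrices. -/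
def sl3Proj (h3 : (3 : F) ≠ 0) : Matrix (Fin 3) (Fin 3) F →ₗ[F] sl3 F :=
  (LinearMap.id - (Matrix.traceLinearMap (Fin 3) F F).smulRight ((3 : F)⁻¹ • 1)).codRestrict _
    fun x => by
      simp [mem_sl3, h3]

lemma coe_sl3Proj (h3 : (3 : F) ≠ 0) (x : Matrix (Fin 3) (Fin 3) F) :
    (sl3Proj h3 x : Matrix (Fin 3) (Fin 3) F) = x - (x.trace / 3) • 1 := by
  simp [sl3Proj, smul_smul, div_eq_mul_inv]

lemma sl3Proj_coe (h3 : (3 : F) ≠ 0) (x : sl3 F) : sl3Proj h3 x = x :=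
  Subtype.ext (by simp [coe_sl3Proj, mem_sl3.mp x.2])

lemma sl3Proj_one (h3 : (3 : F) ≠ 0) : sl3Proj h3 1 = 0 :=
  Subtype.ext (by simp [coe_sl3Proj, h3])

lemma okm_sub_okm_swap {ω : F} (hω : ω ^ 2 + ω + 1 = 0) (x y : Matrix (Fin 3) (Fin 3) F) :
    okm ω x y - okm ω y x = y * x - x * y := by
  have h : okm ω x y - okm ω y x = (ω + ω ^ 2) • (x * y - y * x) := by
    simp only [okm, Matrix.trace_mul_comm y x]
    module
  rw [h, show ω + ω ^ 2 = -1 by linear_combination hω]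
  simp

lemma okmS_sub_okmS_swap {ω : F} (hω : ω ^ 2 + ω + 1 = 0) (hω1 : ω ≠ 1) (x y : sl3 F) :
    ((okmS ω hω hω1 x y - okmS ω hω hω1 y x : sl3 F) : Matrix (Fin 3) (Fin 3) F) =
      (y : Matrix (Fin 3) (Fin 3) F) * x - x * y :=
  okm_sub_okm_swap hω _ _

lemma okmS_add_smul_okmS_swap {ω : F} (hω : ω ^ 2 + ω + 1 = 0) (hω1 : ω ≠ 1) (h3 : (3 : F) ≠ 0)
    (x y : sl3 F) :
    okmS ω hω hω1 x y + ω • okmS ω hω hω1 y x =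
      (ω - 1) • sl3Proj h3 ((x : Matrix (Fin 3) (Fin 3) F) * y) := by
  have hcube : ω ^ 3 = 1 := by linear_combination (ω - 1) * hω
  apply Subtype.ext
  simp only [okmS, Submodule.coe_add, Submodule.coe_smul, coe_sl3Proj, okm,
    Matrix.trace_mul_comm (y : Matrix (Fin 3) (Fin 3) F) x]
  match_scalars
  · linear_combination -hcube
  · ring
  · linear_combination (Matrix.trace (x.1 * y.1) / 3) * hcube

/-- A derivation of the Okubo product is a derivation of the traceless part of the matrix
product. -/
lemma map_sl3Proj_mul_of_okmS_leibniz {ω : F} (hω : ω ^ 2 + ω + 1 = 0) (hω1 : ω ≠ 1)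
    (h3 : (3 : F) ≠ 0) (d : sl3 F →ₗ[F] sl3 F)
    (hd : ∀ x y : sl3 F, d (okmS ω hω hω1 x y) =
      okmS ω hω hω1 (d x) y + okmS ω hω hω1 x (d y)) (x y : sl3 F) :
    d (sl3Proj h3 ((x : Matrix (Fin 3) (Fin 3) F) * y)) =
      sl3Proj h3 ((d x : Matrix (Fin 3) (Fin 3) F) * y + (x : Matrix (Fin 3) (Fin 3) F) * d y) := by
  apply smul_right_injective _ (sub_ne_zero.mpr hω1)
  simp only [map_add, smul_add, ← map_smul d, ← okmS_add_smul_okmS_swap hω hω1 h3]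
  simp only [map_smul, hd]
  module

/-- A linear map on `sl₃` which is a derivation of the traceless part of the matrix product is
the commutator with a traceless matrix. -/
lemma exists_sl3_eq_mul_sub_mul (h3 : (3 : F) ≠ 0) (d : sl3 F →ₗ[F] sl3 F)
    (hd : ∀ x y : sl3 F, d (sl3Proj h3 ((x : Matrix (Fin 3) (Fin 3) F) * y)) =
      sl3Proj h3 ((d x : Matrix (Fin 3) (Fin 3) F) * y + (x : Matrix (Fin 3) (Fin 3) F) * d y)) :
    ∃ a : sl3 F, ∀ y : sl3 F, (d y : Matrix (Fin 3) (Fin 3) F) =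
      (y : Matrix (Fin 3) (Fin 3) F) * a - a * y := by
  let D : Matrix (Fin 3) (Fin 3) F →ₗ[F] Matrix (Fin 3) (Fin 3) F :=
    (sl3 F).subtype ∘ₗ d ∘ₗ sl3Proj h3
  have hcoe (x : sl3 F) : D x = d x := by simp [D, sl3Proj_coe]
  have h1 : D 1 = 0 := by simp [D, sl3Proj_one]
  have hmod (x y : sl3 F) : ∃ c : F, D ((x : Matrix (Fin 3) (Fin 3) F) * y) =
      D x * y + x * D y + c • (1 : Matrix (Fin 3) (Fin 3) F) := by
    refine ⟨-(((d x : Matrix (Fin 3) (Fin 3) F) * y +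
      (x : Matrix (Fin 3) (Fin 3) F) * d y).trace / 3), ?_⟩
    rw [hcoe, hcoe, neg_smul, ← sub_eq_add_neg, ← coe_sl3Proj h3, ← hd]
    rfl
  have hdecomp (x : Matrix (Fin 3) (Fin 3) F) :
      ∃ (u : sl3 F) (s : F), x = u + s • (1 : Matrix (Fin 3) (Fin 3) F) :=
    ⟨sl3Proj h3 x, x.trace / 3, by simp [coe_sl3Proj]⟩
  have hD (x y) : ∃ c : F,
      D (x * y) = D x * y + x * D y + c • (1 : Matrix (Fin 3) (Fin 3) F) := by
    obtain ⟨u, s, rfl⟩ := hdecomp x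
    obtain ⟨v, t, rfl⟩ := hdecomp y
    obtain ⟨c, hc⟩ := hmod u v
    refine ⟨c, ?_⟩
    simp only [add_mul, mul_add, smul_mul_assoc, mul_smul_comm, one_mul, mul_one, map_add,
      map_smul, h1, hc, smul_zero, add_zero]
    module
  obtain ⟨m, hm⟩ := exists_eq_mul_sub_mul_of_leibniz D (leibniz_of_leibniz_mod_scalars D h1 hD)
  refine ⟨-sl3Proj h3 m, fun y => ?_⟩
  rw [← hcoe, hm]
  simp only [Submodule.coe_neg, coe_sl3Proj, mul_neg, neg_mul, mul_sub, sub_mul, mul_smul_comm,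
    smul_mul_assoc, one_mul, mul_one]
  abel

/-- A traceless matrix commuting with all traceless matrices vanishes. -/
lemma eq_zero_of_forall_sl3_commute (h3 : (3 : F) ≠ 0) (a : sl3 F)
    (ha : ∀ y : sl3 F, (y : Matrix (Fin 3) (Fin 3) F) * a = a * y) : a = 0 := by
  have hcenter : (a : Matrix (Fin 3) (Fin 3) F) ∈
      Subalgebra.center F (Matrix (Fin 3) (Fin 3) F) := by
    rw [Subalgebra.mem_center_iff]
    intro x
    have h := ha (sl3Proj h3 x)
    simpa [coe_sl3Proj, sub_mul, mul_sub] using h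
  obtain ⟨t, ht⟩ := Algebra.mem_bot.mp (Algebra.IsCentral.out hcenter)
  rw [← sl3Proj_coe h3 a, ← ht, Algebra.algebraMap_eq_smul_one, map_smul, sl3Proj_one, smul_zero]

/-- Commutators are derivations of the Okubo product. -/
lemma okm_mul_sub_mul_okm (ω : F) (a x y : Matrix (Fin 3) (Fin 3) F) :
    okm ω x y * a - a * okm ω x y = okm ω (x * a - a * x) y + okm ω x (y * a - a * y) := by
  have htr : ((x * a - a * x) * y).trace = -(x * (y * a - a * y)).trace := by
    have h := Matrix.trace_mul_comm a (x * y)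
    simp only [sub_mul, mul_sub, Matrix.trace_sub, ← mul_assoc] at h ⊢
    linear_combination -h
  simp only [okm, htr]
  simp only [sub_mul, mul_sub, smul_mul_assoc, mul_smul_comm, one_mul, mul_one,
    mul_assoc]
  module

/-- Over an algebraically closed field of characteristic `≠ 3` (with a
primitive cube root of unity `ω`), a linear endomorphism `d` of `O = sl₃(F)` is a
derivation of the Okubo product if and only if `d = ad*_a : y ↦ a*y - y*a` for a unique
`a ∈ O`.  Moreover `a ↦ ad*_a` is a homomorphism for the bracket `[a,b]* = a*b - b*a`,
so `Der(O,*) = {ad*_a : a ∈ O}` is isomorphic to `sl₃(F)` as a Lie algebra. -/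
theorem okubo_matrix_derivations (F : Type) [Field F] [IsAlgClosed F]
    (ω : F) (hω : ω ^ 2 + ω + 1 = 0) (hω1 : ω ≠ 1)
    (d : sl3 F →ₗ[F] sl3 F) :
    ((∀ x y : sl3 F, d (okmS ω hω hω1 x y) =
        okmS ω hω hω1 (d x) y + okmS ω hω hω1 x (d y)) ↔
      (∃! a : sl3 F, ∀ y : sl3 F,
        d y = okmS ω hω hω1 a y - okmS ω hω hω1 y a)) ∧
    (∀ a b y : sl3 F,
      okmS ω hω hω1 (okmS ω hω hω1 a b - okmS ω hω hω1 b a) y -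
        okmS ω hω hω1 y (okmS ω hω hω1 a b - okmS ω hω hω1 b a) =
      (okmS ω hω hω1 a (okmS ω hω hω1 b y - okmS ω hω hω1 y b) -
        okmS ω hω hω1 (okmS ω hω hω1 b y - okmS ω hω hω1 y b) a) -
      (okmS ω hω hω1 b (okmS ω hω hω1 a y - okmS ω hω hω1 y a) -
        okmS ω hω hω1 (okmS ω hω hω1 a y - okmS ω hω hω1 y a) b)) := by
  have h3 := okubo_okubo_three_ne_zero ω hω hω1
  refine ⟨⟨fun hd => ?_, ?_⟩, fun a b y => ?_⟩
  · obtain ⟨a, ha⟩ := exists_sl3_eq_mul_sub_mul h3 d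
      (map_sl3Proj_mul_of_okmS_leibniz hω hω1 h3 d hd)
    refine ⟨a, fun y => Subtype.ext ?_, fun b hb => ?_⟩
    · rw [okmS_sub_okmS_swap, ha]
    · refine sub_eq_zero.mp (eq_zero_of_forall_sl3_commute h3 (b - a) fun y => ?_)
      have h := congrArg Subtype.val (hb y)
      rw [okmS_sub_okmS_swap, ha] at h
      rw [Submodule.coe_sub, mul_sub, sub_mul, sub_eq_sub_iff_sub_eq_sub, h]
  · rintro ⟨a, ha, -⟩ x y
    have hcoe (z : sl3 F) : (d z : Matrix (Fin 3) (Fin 3) F) =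
        (z : Matrix (Fin 3) (Fin 3) F) * a - a * z := by
      rw [ha, okmS_sub_okmS_swap]
    apply Subtype.ext
    rw [hcoe, Submodule.coe_add]
    simp only [okmS, hcoe]
    exact okm_mul_sub_mul_okm ω _ _ _
  · apply Subtype.ext
    rw [Submodule.coe_sub (sl3 F) (_ - _)]
    simp only [okmS_sub_okmS_swap]
    noncomm_ring
end

section
/- Let F be algebraically closed of characteristic 3. Every F-linear bijection φ of A with φ(u ⋄ v) = φ(u) ⋄ φ(v) for all u, v maps the subspace O = {f ∈ A | f(0) = 0} bijectively onto itself, and its restriction φ|_O is an automorphism of (O, *), where x*y := p(x ⋄ y); moreover the map φ ↦ φ|_O is a group isomorphism from the group of ⋄-automorphisms of A onto the group of *-automorphisms of O. -/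
open scoped BigOperators

/-- The grading group `ℤ₃ × ℤ₃`. -/
abbrev OkG : Type := ZMod 3 × ZMod 3

variable (F : Type) [Field F]

/-- The structure constants `c(g,h) = 1 - ((g₁h₂ - g₂h₁).val : ℤ)`. -/
def okc (g h : OkG) : F :=
  ((1 - (((g.1 * h.2 - g.2 * h.1 : ZMod 3)).val : ℤ) : ℤ) : F)

/-- Underlying function of the diamond multiplication on `A = F[x,y]` (with basis
`(E_g)_{g ∈ G}`). -/
def dMulFun (x y : OkG → F) : OkG → F := fun k =>
  ∑ g : OkG, ∑ h : OkG, (if g + h = k then okc F g h else 0) * (x g * y h)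

/-- The diamond multiplication on the nodal algebra `A`: the unique `F`-bilinear map with
`E_g ⋄ E_h = c(g,h) • E_(g+h)` for all `g, h ∈ G`. -/
def dMul : (OkG → F) →ₗ[F] (OkG → F) →ₗ[F] (OkG → F) :=
  LinearMap.mk₂ F (dMulFun F)
    (by intro m₁ m₂ n; funext k; simp [dMulFun, add_mul, mul_add, Finset.sum_add_distrib])
    (by intro c m n; funext k
        simp only [dMulFun, Pi.smul_apply, smul_eq_mul, Finset.mul_sum]
        exact Finset.sum_congr rfl fun g _ => Finset.sum_congr rfl fun h _ => by ring)
    (by intro m n₁ n₂; funext k; simp [dMulFun, add_mul, mul_add, Finset.sum_add_distrib])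
    (by intro c m n; funext k
        simp only [dMulFun, Pi.smul_apply, smul_eq_mul, Finset.mul_sum]
        exact Finset.sum_congr rfl fun g _ => Finset.sum_congr rfl fun h _ => by ring)

/-- The subspace `O = {f ∈ A | f(0) = 0}`, i.e. the span of the `E_g` with `g ≠ 0`:
the underlying space of the split Okubo algebra. -/
def Osub : Submodule F (OkG → F) := LinearMap.ker (LinearMap.proj (0 : OkG))

/-- The linear projection `p : A → O` with `p(E_0) = 0` and `p(E_g) = E_g` for `g ≠ 0`. -/
def okProj : (OkG → F) →ₗ[F] (OkG → F) where
  toFun f := f - f 0 • (Pi.single (0 : OkG) 1 : OkG → F)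
  map_add' := by intro a b; simp only [Pi.add_apply, add_smul]; abel
  map_smul' := by
    intro c a
    simp only [Pi.smul_apply, smul_eq_mul, RingHom.id_apply, mul_smul, smul_sub]

/-- The split Okubo product `x * y = p(x ⋄ y)` on the ambient space. -/
def pMul (x y : OkG → F) : OkG → F := okProj F (dMul F x y)

lemma pMul_mem (x y : OkG → F) : pMul F x y ∈ Osub F := by
  simp [pMul, Osub, okProj, LinearMap.mem_ker]

/-- The split Okubo product as an operation on the subspace `O`. -/
def pMulS (x y : Osub F) : Osub F := ⟨pMul F (x : OkG → F) (y : OkG → F), pMul_mem F _ _⟩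

/-- The element `E_g` of the standard basis of `A`. -/
abbrev okE (g : OkG) : OkG → F := Pi.single g 1

lemma dMul_apply (x y : OkG → F) (k : OkG) :
    dMul F x y k = ∑ g : OkG, ∑ h : OkG, (if g + h = k then okc F g h else 0) * (x g * y h) :=
  rfl

lemma dMul_okE (g h : OkG) : dMul F (okE F g) (okE F h) = okc F g h • okE F (g + h) := by
  funext k
  rw [dMul_apply, Finset.sum_eq_single g, Finset.sum_eq_single h]
  · by_cases hk : g + h = k
    · simp [hk]
    · simp [hk, Ne.symm hk]
  · intro b _ hb
    simp [hb]
  · simp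
  · intro b _ hb
    simp [hb]
  · simp

lemma okc_zero_left (g : OkG) : okc F 0 g = 1 := by simp [okc]

lemma okc_zero_right (g : OkG) : okc F g 0 = 1 := by simp [okc]

lemma okc_neg_right (g : OkG) : okc F g (-g) = 1 := by
  simp [okc, mul_comm g.2]

lemma dMul_okE_zero_left (x : OkG → F) : dMul F (okE F 0) x = x := by
  have h : dMul F (okE F 0) = LinearMap.id :=
    (Pi.basisFun F OkG).ext fun g => by simp [dMul_okE, okc_zero_left]
  rw [h, LinearMap.id_apply]

lemma dMul_okE_zero_right (x : OkG → F) : dMul F x (okE F 0) = x := by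
  have h : (dMul F).flip (okE F 0) = LinearMap.id :=
    (Pi.basisFun F OkG).ext fun g => by simp [dMul_okE, okc_zero_right]
  rw [← LinearMap.flip_apply, h, LinearMap.id_apply]

/-- The coefficient of `E_0` in a diamond product, a symmetric bilinear form. -/
lemma dMul_apply_zero (x y : OkG → F) : dMul F x y 0 = ∑ g : OkG, x g * y (-g) := by
  rw [dMul_apply]
  refine Finset.sum_congr rfl fun g _ => ?_
  rw [Finset.sum_eq_single (-g)]
  · simp [okc_neg_right]
  · intro h _ hh
    have : g + h ≠ 0 := fun e => hh (neg_eq_of_add_eq_zero_right e).symm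
    simp [this]
  · simp

lemma dMul_apply_zero_comm (x y : OkG → F) : dMul F x y 0 = dMul F y x 0 := by
  rw [dMul_apply_zero, dMul_apply_zero, ← Equiv.sum_comp (Equiv.neg OkG)]
  exact Finset.sum_congr rfl fun g _ => by simp [mul_comm]

lemma mem_Osub {x : OkG → F} : x ∈ Osub F ↔ x 0 = 0 := Iff.rfl

lemma okE_mem_Osub {g : OkG} (hg : g ≠ 0) : okE F g ∈ Osub F := by
  simp [mem_Osub, hg.symm]

lemma okProj_apply (x : OkG → F) : okProj F x = x - x 0 • okE F 0 := rfl

lemma okProj_mem (x : OkG → F) : okProj F x ∈ Osub F := by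
  simp [mem_Osub, okProj_apply]

lemma okProj_okE_of_ne {g : OkG} (hg : g ≠ 0) : okProj F (okE F g) = okE F g := by
  simp [okProj_apply, hg.symm]

lemma okProj_okE_zero : okProj F (okE F 0) = 0 := by
  simp [okProj_apply]

/-- `O` is spanned by the `E_g` with `g ≠ 0`. -/
@[elab_as_elim]
lemma Osub_induction {P : (OkG → F) → Prop} (single : ∀ g ≠ 0, P (okE F g))
    (zero : P 0) (add : ∀ x y, P x → P y → P (x + y)) (smul : ∀ (c : F) x, P x → P (c • x))
    {x : OkG → F} (hx : x ∈ Osub F) : P x := by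
  have e : x = ∑ g, x g • okE F g := (pi_eq_sum_univ' x).trans
    (Finset.sum_congr rfl fun g _ => by congr 1)
  rw [e]
  refine Finset.sum_induction _ P add zero fun g _ => ?_
  by_cases hg : g = 0
  · rw [hg, (mem_Osub F).1 hx, zero_smul]
    exact zero
  · exact smul _ _ (single g hg)

/-- The Okubo product as a bilinear map. -/
def pMulLin : (OkG → F) →ₗ[F] (OkG → F) →ₗ[F] (OkG → F) := (dMul F).compr₂ (okProj F)

lemma pMulLin_apply (x y : OkG → F) : pMulLin F x y = pMul F x y := rfl

section CharThree

variable [CharP F 3]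

lemma okc_eq_cast (g h : OkG) :
    okc F g h = ZMod.castHom (dvd_refl 3) F (1 - (g.1 * h.2 - g.2 * h.1)) := by
  rw [okc, ← map_intCast (ZMod.castHom (dvd_refl 3) F)]
  congr 1
  push_cast
  rw [ZMod.natCast_zmod_val]

/-- Every `E_g` with `g ≠ 0` is a commutator for the diamond product. -/
lemma exists_okE_eq_commutator {g : OkG} (hg : g ≠ 0) :
    ∃ h k, okE F g = dMul F (okE F h) (okE F k) - dMul F (okE F k) (okE F h) := by
  have key : ∀ g : OkG, g ≠ 0 → ∃ h k : OkG, h + k = g ∧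
      (1 - (h.1 * k.2 - h.2 * k.1)) - (1 - (k.1 * h.2 - k.2 * h.1)) = 1 := by decide
  obtain ⟨h, k, hk, e⟩ := key g hg
  refine ⟨h, k, ?_⟩
  rw [dMul_okE, dMul_okE, add_comm k h, hk, ← sub_smul, okc_eq_cast, okc_eq_cast, ← map_sub, e,
    map_one, one_smul]

lemma pMulLin_okE (g h : OkG) : pMulLin F (okE F g) (okE F h) =
    ZMod.castHom (dvd_refl 3) F (if g + h = 0 then 0 else 1 - (g.1 * h.2 - g.2 * h.1)) •
      okE F (g + h) := by
  rw [pMulLin, LinearMap.compr₂_apply, dMul_okE, map_smul, okc_eq_cast]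
  split_ifs with e
  · rw [e, okProj_okE_zero, smul_zero, map_zero, zero_smul]
  · rw [okProj_okE_of_ne F e]

lemma dMul_okE_apply_zero (g h : OkG) :
    dMul F (okE F g) (okE F h) 0 =
      ZMod.castHom (dvd_refl 3) F (if g + h = 0 then 1 else 0) := by
  rw [dMul_okE]
  split_ifs with e
  · rw [← neg_eq_of_add_eq_zero_right e, okc_neg_right]
    simp
  · simp [Ne.symm e]

lemma pMulLin_okE_triple {g h k : OkG} (hg : g ≠ 0) (hh : h ≠ 0) (hk : k ≠ 0) :
    pMulLin F (pMulLin F (okE F g) (okE F h)) (okE F k) +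
      pMulLin F (pMulLin F (okE F k) (okE F h)) (okE F g) =
      dMul F (okE F g) (okE F k) 0 • okE F h := by
  have key : ∀ g : OkG, g ≠ 0 → ∀ h : OkG, h ≠ 0 → ∀ k : OkG, k ≠ 0 →
      ((if g + h = 0 then 0 else 1 - (g.1 * h.2 - g.2 * h.1)) *
        (if g + h + k = 0 then 0 else 1 - ((g + h).1 * k.2 - (g + h).2 * k.1)) +
      (if k + h = 0 then 0 else 1 - (k.1 * h.2 - k.2 * h.1)) *
        (if k + h + g = 0 then 0 else 1 - ((k + h).1 * g.2 - (k + h).2 * g.1)) : ZMod 3) =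
      if g + k = 0 then 1 else 0 := by decide +kernel
  have e : okE F (k + h + g) = okE F (g + h + k) := congrArg _ (by abel)
  simp only [pMulLin_okE, map_smul, LinearMap.smul_apply, smul_smul, dMul_okE_apply_zero]
  rw [← map_mul, ← map_mul, e, ← add_smul, ← map_add, key g hg h hh k hk]
  split_ifs with gk
  · rw [show g + h + k = h by rw [add_right_comm, gk, zero_add]]
  · simp

/-- The linearized symmetric composition identity of the Okubo algebra. -/
lemma pMul_pMul_add {x y z : OkG → F} (hx : x ∈ Osub F) (hy : y ∈ Osub F) (hz : z ∈ Osub F) :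
    pMul F (pMul F x y) z + pMul F (pMul F z y) x = dMul F x z 0 • y := by
  simp only [← pMulLin_apply]
  refine Osub_induction F (fun g hg => ?_) (by simp) (fun a b ha hb => ?_) (fun c a ha => ?_) hx
  · refine Osub_induction F (fun h hh => ?_) (by simp) (fun a b ha hb => ?_) (fun c a ha => ?_) hy
    · refine Osub_induction F (fun k hk => pMulLin_okE_triple F hg hh hk) (by simp)
        (fun a b ha hb => ?_) (fun c a ha => ?_) hz
      · simp only [map_add, LinearMap.add_apply, Pi.add_apply, add_smul, ← ha, ← hb]
        abel
      · simp only [map_smul, LinearMap.smul_apply, Pi.smul_apply, smul_assoc, ← ha, smul_add]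
    · simp only [map_add, LinearMap.add_apply, smul_add, ← ha, ← hb]
      abel
    · simp only [map_smul, LinearMap.smul_apply, smul_comm _ c a, ← ha, smul_add]
  · simp only [map_add, LinearMap.add_apply, Pi.add_apply, add_smul, ← ha, ← hb]
    abel
  · simp only [map_smul, LinearMap.smul_apply, Pi.smul_apply, smul_assoc, ← ha, smul_add]

end CharThree

section Automorphisms

variable {F}

lemma map_okE_zero {φ : (OkG → F) ≃ₗ[F] (OkG → F)}
    (hφ : ∀ u v, φ (dMul F u v) = dMul F (φ u) (φ v)) : φ (okE F 0) = okE F 0 := by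
  have h := hφ (okE F 0) (φ.symm (okE F 0))
  rwa [dMul_okE_zero_left, φ.apply_symm_apply, dMul_okE_zero_right, eq_comm] at h

lemma map_mem_Osub [CharP F 3] {φ : (OkG → F) ≃ₗ[F] (OkG → F)}
    (hφ : ∀ u v, φ (dMul F u v) = dMul F (φ u) (φ v)) {x : OkG → F} (hx : x ∈ Osub F) :
    φ x ∈ Osub F := by
  refine Osub_induction F (fun g hg => ?_) (by simp) (fun a b ha hb => ?_) (fun c a ha => ?_) hx
  · obtain ⟨h, k, e⟩ := exists_okE_eq_commutator F hg
    rw [e, map_sub, hφ, hφ, mem_Osub, Pi.sub_apply, dMul_apply_zero_comm, sub_self]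
  · rw [map_add]
    exact add_mem ha hb
  · rw [map_smul]
    exact Submodule.smul_mem _ c ha

lemma symm_dMul {φ : (OkG → F) ≃ₗ[F] (OkG → F)}
    (hφ : ∀ u v, φ (dMul F u v) = dMul F (φ u) (φ v)) (u v : OkG → F) :
    φ.symm (dMul F u v) = dMul F (φ.symm u) (φ.symm v) := by
  rw [LinearEquiv.symm_apply_eq, hφ, φ.apply_symm_apply, φ.apply_symm_apply]

lemma map_Osub [CharP F 3] {φ : (OkG → F) ≃ₗ[F] (OkG → F)}
    (hφ : ∀ u v, φ (dMul F u v) = dMul F (φ u) (φ v)) :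
    Submodule.map (φ : (OkG → F) →ₗ[F] (OkG → F)) (Osub F) = Osub F := by
  refine le_antisymm (Submodule.map_le_iff_le_comap.2 fun x hx => map_mem_Osub hφ hx)
    fun x hx => ?_
  exact ⟨φ.symm x, map_mem_Osub (symm_dMul hφ) hx, φ.apply_symm_apply x⟩

lemma map_okProj [CharP F 3] {φ : (OkG → F) ≃ₗ[F] (OkG → F)}
    (hφ : ∀ u v, φ (dMul F u v) = dMul F (φ u) (φ v)) (w : OkG → F) :
    φ (okProj F w) = okProj F (φ w) := by
  have h : φ (okProj F w) = φ w - w 0 • okE F 0 := by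
    rw [okProj_apply, map_sub, map_smul, map_okE_zero hφ]
  have h0 : φ w 0 = w 0 := by
    have := (mem_Osub F).1 (map_mem_Osub hφ (okProj_mem F w))
    rw [h] at this
    simpa [sub_eq_zero] using this
  rw [h, okProj_apply, h0]

lemma map_pMul [CharP F 3] {φ : (OkG → F) ≃ₗ[F] (OkG → F)}
    (hφ : ∀ u v, φ (dMul F u v) = dMul F (φ u) (φ v)) (x y : OkG → F) :
    φ (pMul F x y) = pMul F (φ x) (φ y) := by
  rw [pMul, map_okProj hφ, hφ, pMul]

/-- The restriction of a diamond automorphism to `O`. -/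
def okRestrict [CharP F 3]
    (φ : {φ : (OkG → F) ≃ₗ[F] (OkG → F) // ∀ u v, φ (dMul F u v) = dMul F (φ u) (φ v)}) :
    {ψ : (Osub F) ≃ₗ[F] (Osub F) // ∀ x y, ψ (pMulS F x y) = pMulS F (ψ x) (ψ y)} :=
  ⟨φ.1.ofSubmodules _ _ (map_Osub φ.2), fun x y => Subtype.ext (map_pMul φ.2 x y)⟩

/-- The projection of `A` onto `O`, with codomain `O`. -/
def okProjS : (OkG → F) →ₗ[F] Osub F := (okProj F).codRestrict _ (okProj_mem F)

lemma okProjS_coe (x : Osub F) : okProjS (x : OkG → F) = x :=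
  Subtype.ext (by
    change okProj F x = x
    rw [okProj_apply, (mem_Osub F).1 x.2, zero_smul, sub_zero])

lemma okProjS_okE_zero : okProjS (okE F 0) = 0 := Subtype.ext (okProj_okE_zero F)

lemma eq_smul_add_okProjS (w : OkG → F) : w = w 0 • okE F 0 + okProjS w := by
  change w = w 0 • okE F 0 + (w - w 0 • okE F 0)
  abel

/-- The extension of a linear endomorphism of `O` to `A` fixing `E_0`. -/
def okExtendLin (ψ : Osub F →ₗ[F] Osub F) : (OkG → F) →ₗ[F] (OkG → F) :=
  (LinearMap.proj (0 : OkG)).smulRight (okE F 0) + (Osub F).subtype ∘ₗ ψ ∘ₗ okProjS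

lemma okExtendLin_apply (ψ : Osub F →ₗ[F] Osub F) (w : OkG → F) :
    okExtendLin ψ w = w 0 • okE F 0 + (ψ (okProjS w) : OkG → F) := rfl

lemma okExtendLin_coe (ψ : Osub F →ₗ[F] Osub F) (x : Osub F) :
    okExtendLin ψ x = (ψ x : OkG → F) := by
  rw [okExtendLin_apply, okProjS_coe, (mem_Osub F).1 x.2, zero_smul, zero_add]

lemma okExtendLin_okE_zero (ψ : Osub F →ₗ[F] Osub F) : okExtendLin ψ (okE F 0) = okE F 0 := by
  simp [okExtendLin_apply, okProjS_okE_zero]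

lemma okExtendLin_okExtendLin (ψ χ : Osub F →ₗ[F] Osub F) (w : OkG → F) :
    okExtendLin ψ (okExtendLin χ w) = okExtendLin (ψ ∘ₗ χ) w := by
  rw [okExtendLin_apply χ, map_add, map_smul, okExtendLin_okE_zero, okExtendLin_coe]
  rfl

lemma okExtendLin_id (w : OkG → F) : okExtendLin (LinearMap.id : Osub F →ₗ[F] Osub F) w = w :=
  (eq_smul_add_okProjS w).symm

/-- The extension of a linear automorphism of `O` to `A` fixing `E_0`. -/
def okExtend (ψ : Osub F ≃ₗ[F] Osub F) : (OkG → F) ≃ₗ[F] (OkG → F) :=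
  LinearEquiv.ofLinearMap (okExtendLin ψ) (okExtendLin ψ.symm)
    (LinearMap.ext fun w => by
      rw [LinearMap.comp_apply, okExtendLin_okExtendLin, LinearEquiv.comp_symm, okExtendLin_id]
      rfl)
    (LinearMap.ext fun w => by
      rw [LinearMap.comp_apply, okExtendLin_okExtendLin, LinearEquiv.symm_comp, okExtendLin_id]
      rfl)

lemma okExtend_coe (ψ : Osub F ≃ₗ[F] Osub F) (x : Osub F) :
    okExtend ψ x = (ψ x : OkG → F) := okExtendLin_coe _ x

lemma okExtend_okE_zero (ψ : Osub F ≃ₗ[F] Osub F) : okExtend ψ (okE F 0) = okE F 0 :=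
  okExtendLin_okE_zero _

/-- Automorphisms of the Okubo algebra are isometries of the bilinear form `(x ⋄ y)(0)`. -/
lemma dMul_apply_zero_map [CharP F 3] {ψ : Osub F ≃ₗ[F] Osub F}
    (hψ : ∀ x y, ψ (pMulS F x y) = pMulS F (ψ x) (ψ y)) (x z : Osub F) :
    dMul F (ψ x) (ψ z) 0 = dMul F x z 0 := by
  have key (x y z : Osub F) : pMulS F (pMulS F x y) z + pMulS F (pMulS F z y) x =
      dMul F (x : OkG → F) z 0 • y := Subtype.ext (pMul_pMul_add F x.2 y.2 z.2)
  let y : Osub F := ⟨okE F (1, 0), okE_mem_Osub F (by decide)⟩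
  have hy : y ≠ 0 := fun e => by simpa [y] using congrFun (congrArg Subtype.val e) (1, 0)
  have h := congrArg ψ (key x y z)
  rw [map_add, hψ, hψ, hψ, hψ, key, map_smul] at h
  exact smul_left_injective F (ψ.map_ne_zero_iff.2 hy) h

lemma dMul_eq_smul_add_pMulS (x y : Osub F) :
    dMul F (x : OkG → F) y = dMul F (x : OkG → F) y 0 • okE F 0 + (pMulS F x y : OkG → F) :=
  eq_smul_add_okProjS _

lemma okExtend_dMul [CharP F 3] {ψ : Osub F ≃ₗ[F] Osub F}
    (hψ : ∀ x y, ψ (pMulS F x y) = pMulS F (ψ x) (ψ y)) (u v : OkG → F) :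
    okExtend ψ (dMul F u v) = dMul F (okExtend ψ u) (okExtend ψ v) := by
  have h (x y : Osub F) : okExtend ψ (dMul F (x : OkG → F) y) =
      dMul F (okExtend ψ x) (okExtend ψ y) := by
    rw [dMul_eq_smul_add_pMulS, map_add, map_smul, okExtend_okE_zero, okExtend_coe, okExtend_coe,
      okExtend_coe, hψ, ← dMul_apply_zero_map hψ, ← dMul_eq_smul_add_pMulS]
  rw [eq_smul_add_okProjS u, eq_smul_add_okProjS v]
  simp only [map_add, map_smul, LinearMap.add_apply, LinearMap.smul_apply, okExtend_okE_zero,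
    dMul_okE_zero_left, dMul_okE_zero_right, h]

lemma okRestrict_injective [CharP F 3] : Function.Injective (okRestrict (F := F)) := by
  intro φ₁ φ₂ h
  refine Subtype.ext (LinearEquiv.ext fun w => ?_)
  have hO (x : Osub F) : φ₁.1 x = φ₂.1 x :=
    congrArg (fun ψ => ((ψ.1 x : Osub F) : OkG → F)) h
  rw [eq_smul_add_okProjS w, map_add, map_add, map_smul, map_smul, map_okE_zero φ₁.2,
    map_okE_zero φ₂.2, hO]

lemma okRestrict_surjective [CharP F 3] : Function.Surjective (okRestrict (F := F)) := fun ψ =>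
  ⟨⟨okExtend ψ.1, okExtend_dMul ψ.2⟩,
    Subtype.ext (LinearEquiv.ext fun x => Subtype.ext (okExtend_coe ψ.1 x))⟩

end Automorphisms

/-- Over an algebraically closed field `F` of characteristic `3`, every
automorphism `φ` of the nodal algebra `(A, ⋄)` maps `O = {f | f(0) = 0}` onto itself and
restricts to an automorphism of the split Okubo algebra `(O, *)`, `x*y = p(x ⋄ y)`;
moreover `φ ↦ φ|_O` is a group isomorphism from the group of automorphisms of `(A, ⋄)`
onto the group of automorphisms of `(O, *)`. -/
theorem nodal_automorphisms_restrict_to_okubo (F : Type) [Field F] [IsAlgClosed F]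
    [CharP F 3] :
    (∀ φ : (OkG → F) ≃ₗ[F] (OkG → F),
      (∀ u v, φ (dMul F u v) = dMul F (φ u) (φ v)) →
      Submodule.map (φ : (OkG → F) →ₗ[F] (OkG → F)) (Osub F) = Osub F ∧
      ∀ x y, x ∈ Osub F → y ∈ Osub F → φ (pMul F x y) = pMul F (φ x) (φ y)) ∧
    ∃ Φ : {φ : (OkG → F) ≃ₗ[F] (OkG → F) // ∀ u v, φ (dMul F u v) = dMul F (φ u) (φ v)} →
          {ψ : (Osub F) ≃ₗ[F] (Osub F) // ∀ x y, ψ (pMulS F x y) = pMulS F (ψ x) (ψ y)},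
      Function.Bijective Φ ∧
      (∀ φ (x : Osub F), ((Φ φ).val x : OkG → F) = φ.val (x : OkG → F)) ∧
      (∀ φ₁ φ₂ : {φ : (OkG → F) ≃ₗ[F] (OkG → F) //
          ∀ u v, φ (dMul F u v) = dMul F (φ u) (φ v)},
        ∀ h₁₂ : ∀ u v, (φ₁.val.trans φ₂.val) (dMul F u v) =
          dMul F ((φ₁.val.trans φ₂.val) u) ((φ₁.val.trans φ₂.val) v),
        (Φ ⟨φ₁.val.trans φ₂.val, h₁₂⟩).val = (Φ φ₁).val.trans (Φ φ₂).val) := by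
  exact ⟨fun φ hφ => ⟨map_Osub hφ, fun x y _ _ => map_pMul hφ x y⟩, okRestrict,
    ⟨okRestrict_injective, okRestrict_surjective⟩, fun _ _ => rfl, fun _ _ _ => rfl⟩
end

section
/- Let F be algebraically closed of characteristic ≠ 3 and let O = sl₃(F) with the Okubo product *. For any two nonzero idempotents f, g of (O,*) (f*f = f ≠ 0, g*g = g ≠ 0) there exists an F-linear bijection φ of O with φ(x*y) = φ(x)*φ(y) for all x, y and φ(f) = g. That is, all nonzero idempotents of the Okubo algebra in characteristic ≠ 3 are conjugate under its automorphism group. -/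
variable {F : Type} [Field F]

/-- Idempotent endomorphisms of equal rank are conjugate. -/
theorem LinearMap.IsIdempotentElem.exists_conj {K V : Type*} [Field K] [AddCommGroup V]
    [Module K V] [FiniteDimensional K V] {p q : V →ₗ[K] V} (hp : IsIdempotentElem p)
    (hq : IsIdempotentElem q)
    (h : Module.finrank K (LinearMap.range p) = Module.finrank K (LinearMap.range q)) :
    ∃ e : V ≃ₗ[K] V, ∀ v, e (p v) = q (e v) := by
  have hker : Module.finrank K (LinearMap.ker p) = Module.finrank K (LinearMap.ker q) := by
    have h₁ := p.finrank_range_add_finrank_ker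
    have h₂ := q.finrank_range_add_finrank_ker
    omega
  let α := LinearEquiv.ofFinrankEq _ _ h
  let β := LinearEquiv.ofFinrankEq _ _ hker
  let P := Submodule.prodEquivOfIsCompl _ _ (LinearMap.IsIdempotentElem.isCompl hp)
  let Q := Submodule.prodEquivOfIsCompl _ _ (LinearMap.IsIdempotentElem.isCompl hq)
  refine ⟨P.symm ≪≫ₗ (α.prodCongr β) ≪≫ₗ Q, fun v => ?_⟩
  obtain ⟨⟨x, y⟩, rfl⟩ := P.surjective v
  have hx : p x = x := (LinearMap.IsIdempotentElem.mem_range_iff hp).1 x.2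
  have hy : p y = 0 := y.2
  have hαx : q (α x) = α x := (LinearMap.IsIdempotentElem.mem_range_iff hq).1 (α x).2
  have hβy : q (β y) = 0 := (β y).2
  have hP : p (P (x, y)) = P (x, 0) := by
    simp [P, hx, hy]
  rw [hP]
  simp [Q, hαx, hβy]

theorem Matrix.exists_cube_eq_of_trace_eq_zero {R : Type*} [CommRing R]
    (A : Matrix (Fin 3) (Fin 3) R) (hA : A.trace = 0) :
    ∃ d e : R, A * (A * A) = d • 1 - e • A ∧ (A * A).trace = -2 * e := by
  have h22 : A 2 2 = -A 0 0 - A 1 1 := by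
    rw [Matrix.trace_fin_three] at hA
    linear_combination hA
  refine ⟨A.det, A 0 0 * A 1 1 - A 0 1 * A 1 0 + A 0 0 * A 2 2 - A 0 2 * A 2 0 +
    A 1 1 * A 2 2 - A 1 2 * A 2 1, ?_, ?_⟩
  · ext i j
    fin_cases i <;> fin_cases j <;>
      simp [Matrix.mul_apply, Fin.sum_univ_three, Matrix.det_fin_three, h22] <;> ring
  · simp [Matrix.trace_fin_three, Matrix.mul_apply, Fin.sum_univ_three, h22]
    ring

theorem Matrix.eq_zero_of_trace_eq_zero_of_eq_smul_one {K : Type*} [Field K] (h3 : (3 : K) ≠ 0)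
    {A : Matrix (Fin 3) (Fin 3) K} (hA : A.trace = 0) {a : K} (h : A = a • 1) : A = 0 := by
  have ha : a = 0 := by simpa [h, h3] using hA
  simp [h, ha]

/-- A trace-zero matrix with `A ^ 2 = c A + t` that is not zero satisfies `t = 2 c ^ 2`. -/
theorem Matrix.eq_two_mul_sq_of_mul_self_eq {K : Type*} [Field K] (h3 : (3 : K) ≠ 0)
    {A : Matrix (Fin 3) (Fin 3) K} (hA : A.trace = 0) (hA0 : A ≠ 0) {c t : K}
    (h : A * A = c • A + t • 1) : t = 2 * c ^ 2 := by
  obtain ⟨d, e, hcube, htr⟩ := A.exists_cube_eq_of_trace_eq_zero hA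
  have hlin : (c ^ 2 + t + e) • A = (d - c * t) • 1 := by
    rw [h, mul_add, mul_smul_comm, h, mul_smul_comm, mul_one] at hcube
    rw [← sub_eq_zero] at hcube ⊢
    rw [← hcube]
    module
  have ht : 3 * t = -2 * e := by
    rw [← htr, h]
    simp [hA, mul_comm]
  by_cases h0 : c ^ 2 + t + e = 0
  · linear_combination ht - 2 * h0
  · refine absurd (Matrix.eq_zero_of_trace_eq_zero_of_eq_smul_one h3 hA
      (a := (c ^ 2 + t + e)⁻¹ * (d - c * t)) ?_) hA0
    rw [mul_smul, ← hlin, inv_smul_smul₀ h0]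

theorem Matrix.finrank_range_toLin'_eq_one {K : Type*} [Field K]
    {P : Matrix (Fin 3) (Fin 3) K} (hP : IsIdempotentElem P) (htr : P.trace = 1) (hP1 : P ≠ 1) :
    Module.finrank K (LinearMap.range (Matrix.toLin' P)) = 1 := by
  have hidem : IsIdempotentElem (Matrix.toLin' P) := by
    rw [IsIdempotentElem, Module.End.mul_eq_comp, ← Matrix.toLin'_mul, hP.eq]
  have hproj : LinearMap.IsProj (LinearMap.range (Matrix.toLin' P)) (Matrix.toLin' P) :=
    ⟨fun x => ⟨x, rfl⟩, fun x hx => (LinearMap.IsIdempotentElem.mem_range_iff hidem).1 hx⟩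
  have hrank := hproj.trace
  rw [Matrix.trace_toLin'_eq, htr] at hrank
  have hle := Submodule.finrank_le (LinearMap.range (Matrix.toLin' P))
  rw [Module.finrank_fin_fun] at hle
  generalize hr : Module.finrank K (LinearMap.range (Matrix.toLin' P)) = r at *
  interval_cases r
  · simp at hrank
  · rfl
  · exact absurd (show (1 : K) = 0 by push_cast at hrank; linear_combination -hrank) one_ne_zero
  · have htop : LinearMap.range (Matrix.toLin' P) = ⊤ :=
      Submodule.eq_top_of_finrank_eq (by rw [hr, Module.finrank_fin_fun])
    refine absurd (Matrix.toLin'.injective ?_) hP1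
    rw [Matrix.toLin'_one]
    exact LinearMap.ext fun x => hproj.map_id x (htop ▸ Submodule.mem_top)

/-- A nonzero idempotent of the Okubo algebra is an affine image of a rank-one projection. -/
theorem okm_idempotent_eq_smul_add {ω : F} (hω : ω ^ 2 + ω + 1 = 0)
    (hω1 : ω ≠ 1) {f : Matrix (Fin 3) (Fin 3) F} (htr : f.trace = 0) (hf : okm ω f f = f)
    (hf0 : f ≠ 0) :
    ∃ P : Matrix (Fin 3) (Fin 3) F, IsIdempotentElem P ∧
      Module.finrank F (LinearMap.range (Matrix.toLin' P)) = 1 ∧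
      f = (-(ω - ω ^ 2)) • P + ((ω - ω ^ 2) / 3) • 1 := by
  have h3 := okubo_okubo_three_ne_zero ω hω hω1
  rw [okm, ← sub_smul] at hf
  obtain ⟨s, hs⟩ : ∃ s, s = ω - ω ^ 2 := ⟨_, rfl⟩
  have hss : s * s = -3 := by
    rw [hs]
    linear_combination (ω ^ 2 - 3 * ω + 3) * hω
  rw [← hs] at hf ⊢
  have hsq : f * f = (-(s / 3)) • f + ((f * f).trace / 3) • 1 := calc
    f * f = (-(s / 3)) • (s • (f * f) - (s / 3 * (f * f).trace) • 1) +
        ((f * f).trace / 3) • 1 := by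
      rw [smul_sub, smul_smul, smul_smul,
        show -(s / 3) * s = 1 by field_simp; linear_combination -hss,
        show -(s / 3) * (s / 3 * (f * f).trace) = (f * f).trace / 3 by
          field_simp; linear_combination -(f * f).trace * hss]
      module
    _ = _ := by rw [hf]
  have ht := Matrix.eq_two_mul_sq_of_mul_self_eq h3 htr hf0 hsq
  rw [ht] at hsq
  have hfP : f = (-s) • ((s / 3) • f + (1 / 3 : F) • 1) + (s / 3) • (1 : Matrix _ _ F) := by
    rw [smul_add, smul_smul, smul_smul,
      show -s * (s / 3) = 1 by field_simp; linear_combination -hss]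
    module
  have hP : IsIdempotentElem ((s / 3) • f + (1 / 3 : F) • (1 : Matrix (Fin 3) (Fin 3) F)) := by
    rw [IsIdempotentElem, add_mul, mul_add, mul_add, smul_mul_smul_comm, hsq]
    simp only [smul_mul_smul_comm, mul_one, one_mul]
    match_scalars
    · field_simp
      linear_combination (-s) * hss
    · field_simp
      linear_combination (2 * s * s - 6) * hss
  refine ⟨_, hP, Matrix.finrank_range_toLin'_eq_one hP (by simp [htr, h3]) fun hP1 => ?_, hfP⟩
  rw [hP1, ← add_smul] at hfP
  exact hf0 (Matrix.eq_zero_of_trace_eq_zero_of_eq_smul_one h3 htr hfP)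

/-- Conjugation by an invertible matrix, restricted to trace-zero matrices. -/
def sl3Conj (A B : Matrix (Fin 3) (Fin 3) F) (hAB : A * B = 1) (hBA : B * A = 1) :
    sl3 F ≃ₗ[F] sl3 F where
  toFun x := ⟨A * x * B, by
    have hx : (x : Matrix (Fin 3) (Fin 3) F).trace = 0 := x.2
    simpa [sl3, Matrix.trace_mul_cycle A _ B, hBA] using hx⟩
  invFun x := ⟨B * x * A, by
    have hx : (x : Matrix (Fin 3) (Fin 3) F).trace = 0 := x.2
    simpa [sl3, Matrix.trace_mul_cycle B _ A, hAB] using hx⟩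
  map_add' x y := by
    ext1
    simp [mul_add, add_mul]
  map_smul' a x := by
    ext1
    simp
  left_inv x := by
    ext1
    simp only [← mul_assoc, hBA, one_mul]
    simp only [mul_assoc, hBA, mul_one]
  right_inv x := by
    ext1
    simp only [← mul_assoc, hAB, one_mul]
    simp only [mul_assoc, hAB, mul_one]

theorem okm_conj (ω : F) {A B : Matrix (Fin 3) (Fin 3) F} (hAB : A * B = 1) (hBA : B * A = 1)
    (x y : Matrix (Fin 3) (Fin 3) F) :
    A * okm ω x y * B = okm ω (A * x * B) (A * y * B) := by
  have hmul (x y : Matrix (Fin 3) (Fin 3) F) : A * x * B * (A * y * B) = A * (x * y) * B := by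
    rw [show A * x * B * (A * y * B) = A * x * (B * A) * y * B by simp only [mul_assoc], hBA]
    simp only [mul_assoc, one_mul]
  have htr : (A * (x * y) * B).trace = (x * y).trace := by
    rw [Matrix.trace_mul_cycle, hBA, one_mul]
  simp only [okm, hmul, htr, mul_sub, sub_mul, mul_smul_comm, smul_mul_assoc, mul_one, hAB]

/-- Over an algebraically closed field of characteristic `≠ 3`, all
nonzero idempotents of the Okubo algebra `(O = sl₃(F), *)` are conjugate under its
automorphism group. -/
theorem okubo_matrix_idempotents_conjugate (F : Type) [Field F] [IsAlgClosed F]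
    (ω : F) (hω : ω ^ 2 + ω + 1 = 0) (hω1 : ω ≠ 1)
    (f g : sl3 F) (hf : okmS ω hω hω1 f f = f) (hf0 : f ≠ 0)
    (hg : okmS ω hω hω1 g g = g) (hg0 : g ≠ 0) :
    ∃ φ : sl3 F ≃ₗ[F] sl3 F,
      (∀ x y : sl3 F, φ (okmS ω hω hω1 x y) = okmS ω hω hω1 (φ x) (φ y)) ∧
      φ f = g := by
  have hf' : okm ω (f : Matrix (Fin 3) (Fin 3) F) f = f := congrArg Subtype.val hf
  have hg' : okm ω (g : Matrix (Fin 3) (Fin 3) F) g = g := congrArg Subtype.val hg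
  obtain ⟨P, hP, hPr, hfP⟩ := okm_idempotent_eq_smul_add hω hω1 f.2 hf' (by simpa using hf0)
  obtain ⟨Q, hQ, hQr, hgQ⟩ := okm_idempotent_eq_smul_add hω hω1 g.2 hg' (by simpa using hg0)
  obtain ⟨e, he⟩ := LinearMap.IsIdempotentElem.exists_conj
    (hP.map (Matrix.toLinAlgEquiv' (R := F))) (hQ.map (Matrix.toLinAlgEquiv' (R := F)))
    (hPr.trans hQr.symm)
  have hAB : LinearMap.toMatrix' (e : (Fin 3 → F) →ₗ[F] (Fin 3 → F)) *
      LinearMap.toMatrix' (e.symm : (Fin 3 → F) →ₗ[F] (Fin 3 → F)) = 1 := by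
    simp [← LinearMap.toMatrix'_comp]
  have hBA : LinearMap.toMatrix' (e.symm : (Fin 3 → F) →ₗ[F] (Fin 3 → F)) *
      LinearMap.toMatrix' (e : (Fin 3 → F) →ₗ[F] (Fin 3 → F)) = 1 := by
    simp [← LinearMap.toMatrix'_comp]
  have hAP : LinearMap.toMatrix' (e : (Fin 3 → F) →ₗ[F] (Fin 3 → F)) * P =
      Q * LinearMap.toMatrix' (e : (Fin 3 → F) →ₗ[F] (Fin 3 → F)) := by
    apply Matrix.toLin'.injective
    rw [Matrix.toLin'_mul, Matrix.toLin'_mul, Matrix.toLin'_toMatrix']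
    exact LinearMap.ext he
  refine ⟨sl3Conj _ _ hAB hBA, fun x y => Subtype.ext (okm_conj ω hAB hBA x y), Subtype.ext ?_⟩
  change _ * (f : Matrix (Fin 3) (Fin 3) F) * _ = (g : Matrix (Fin 3) (Fin 3) F)
  rw [hfP, hgQ, mul_add, add_mul, mul_smul_comm, smul_mul_assoc, hAP, mul_assoc, hAB,
    mul_smul_comm, smul_mul_assoc, mul_one, mul_one, hAB]
end
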